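/- (Lipschitz regularity and derivative of the minimal distance) Let T > 0 and δ ∈ (0, π], and let z : 𝕋 × [0,T) → ℝ² (𝕋 = ℝ/2πℤ) be continuous, differentiable in t with ∂_t z jointly continuous on 𝕋 × [0,T). Define m(t) := min { |z(ξ,t) − z(η,t)| : ξ, η ∈ 𝕋, |ξ−η| ≥ δ }, where |ξ−η| is distance on 𝕋, and assume m(t) > 0 for all t ∈ [0,T). Then m is locally Lipschitz on [0,T), and for almost every t ∈ [0,T), m is differentiable at t and m'(t) = ( (z(ξ_t,t) − z(η_t,t)) / m(t) ) · ( ∂_t z(ξ_t,t) − ∂_t z(η_t,t) ) for every pair (ξ_t, η_t) with |ξ_t − η_t| ≥ δ attaining the minimum m(t). -/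

import Mathlib

open Real Set Filter MeasureTheory

noncomputable section

abbrev R2 : Type := EuclideanSpace ℝ (Fin 2)

/-- The Euclidean dot product on the plane. -/
def dot (x y : R2) : ℝ := x 0 * y 0 + x 1 * y 1

/-- The distance on the torus `𝕋 = ℝ/2πℤ` between (the classes of) two reals. -/
def distT (ξ η : ℝ) : ℝ := ⨅ k : ℤ, |ξ - η + 2 * π * k|

theorem distT_pi_zero : π ≤ distT π 0 := by
  unfold distT
  refine le_ciInf fun k => ?_
  have h1 : (1 : ℝ) ≤ |1 + 2 * (k : ℝ)| := by
    have : (1 : ℤ) ≤ |1 + 2 * k| := Int.one_le_abs (by omega)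
    exact_mod_cast this
  have h2 : π - 0 + 2 * π * k = π * (1 + 2 * (k : ℝ)) := by ring
  rw [h2, abs_mul, abs_of_pos pi_pos]
  nlinarith [pi_pos]

/-- (Lipschitz regularity and derivative of the minimal distance) Let `T > 0`, `δ ∈ (0,π]`,
and let `z : 𝕋 × [0,T) → ℝ²` be continuous and differentiable in `t` with jointly continuous
time derivative `w = ∂_t z`. Let `m(t)` be the minimum of `|z(ξ,t) − z(η,t)|` over pairs with
`|ξ−η| ≥ δ` on the torus, and assume `m > 0` on `[0,T)`. Then `m` is locally Lipschitz on
`[0,T)` and, for a.e. `t ∈ [0,T)`, `m` is differentiable at `t` with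
`m'(t) = ((z(ξ_t,t) − z(η_t,t))/m(t)) · (∂_t z(ξ_t,t) − ∂_t z(η_t,t))` for every minimizing
pair `(ξ_t, η_t)`. -/
theorem minimal_distance_regularity (T δ : ℝ) (hT : 0 < T) (hδ0 : 0 < δ) (hδπ : δ ≤ π)
    (z w : ℝ → ℝ → R2)
    (hper : ∀ ξ t : ℝ, z (ξ + 2 * π) t = z ξ t)
    (hzcont : ContinuousOn (fun p : ℝ × ℝ => z p.1 p.2) (univ ×ˢ Ico 0 T))
    (hderiv : ∀ ξ : ℝ, ∀ t ∈ Ico 0 T,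
      HasDerivWithinAt (fun s => z ξ s) (w ξ t) (Ico 0 T) t)
    (hwcont : ContinuousOn (fun p : ℝ × ℝ => w p.1 p.2) (univ ×ˢ Ico 0 T))
    (m : ℝ → ℝ)
    (hm : ∀ t : ℝ, m t = sInf {d : ℝ | ∃ ξ η : ℝ, δ ≤ distT ξ η ∧ d = ‖z ξ t - z η t‖})
    (hmpos : ∀ t ∈ Ico 0 T, 0 < m t) :
    (∀ T' ∈ Ioo 0 T, ∃ K : NNReal, LipschitzOnWith K m (Icc 0 T')) ∧
      (∀ᵐ t : ℝ, t ∈ Ico 0 T →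
        ∀ ξ η : ℝ, δ ≤ distT ξ η → ‖z ξ t - z η t‖ = m t →
          HasDerivAt m ((m t)⁻¹ * dot (z ξ t - z η t) (w ξ t - w η t)) t) := by
  have hbdd : ∀ t : ℝ, BddBelow {d : ℝ | ∃ ξ η : ℝ, δ ≤ distT ξ η ∧ d = ‖z ξ t - z η t‖} := by
    intro t
    refine ⟨0, ?_⟩
    rintro d ⟨ξ, η, -, rfl⟩
    exact norm_nonneg _
  have hle : ∀ t ξ η : ℝ, δ ≤ distT ξ η → m t ≤ ‖z ξ t - z η t‖ := by
    intro t ξ η h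
    rw [hm]
    exact csInf_le (hbdd t) ⟨ξ, η, h, rfl⟩
  have hlip : ∀ T' ∈ Ioo 0 T, ∃ K : NNReal, LipschitzOnWith K m (Icc 0 T') := by
    intro T' hT'
    have hsub : Icc 0 T' ⊆ Ico 0 T := fun x hx => ⟨hx.1, hx.2.trans_lt hT'.2⟩
    have hcomp : IsCompact (Icc 0 (2 * π) ×ˢ Icc 0 T') := isCompact_Icc.prod isCompact_Icc
    obtain ⟨C, hC⟩ := hcomp.exists_bound_of_continuousOn
      (hwcont.mono (prod_mono (subset_univ _) hsub))
    have hz0 : ∀ ξ ∈ Icc 0 (2 * π), ∀ s ∈ Icc 0 T', ∀ t ∈ Icc 0 T',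
        ‖z ξ t - z ξ s‖ ≤ C * |t - s| := by
      intro ξ hξ s hs t ht
      exact Convex.norm_image_sub_le_of_norm_hasDerivWithin_le (f := fun s => z ξ s)
        (f' := fun s => w ξ s) (s := Icc 0 T')
        (fun x hx => (hderiv ξ x (hsub hx)).mono hsub)
        (fun x hx => hC (ξ, x) ⟨hξ, hx⟩) (convex_Icc _ _) hs ht
    have hz : ∀ ξ : ℝ, ∀ s ∈ Icc 0 T', ∀ t ∈ Icc 0 T', ‖z ξ t - z ξ s‖ ≤ C * |t - s| := by
      intro ξ s hs t ht
      have hp : Function.Periodic (fun ξ => z ξ) (2 * π) := fun ξ => funext (hper ξ)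
      obtain ⟨y, hy, hy'⟩ := hp.exists_mem_Ico₀ two_pi_pos ξ
      have hy'' : z ξ = z y := hy'
      rw [hy'']
      exact hz0 y ⟨hy.1, hy.2.le⟩ s hs t ht
    have key : ∀ s ∈ Icc 0 T', ∀ t ∈ Icc 0 T', m t ≤ m s + 2 * C * |t - s| := by
      intro s hs t ht
      have : m t - 2 * C * |t - s| ≤ m s := by
        rw [hm s]
        refine le_csInf ⟨_, π, 0, hδπ.trans distT_pi_zero, rfl⟩ ?_
        rintro d ⟨ξ, η, h, rfl⟩
        have h1 := hle t ξ η h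
        have h2 := hz ξ s hs t ht
        have h3 := hz η s hs t ht
        have h4 : z ξ t - z η t = (z ξ s - z η s) + ((z ξ t - z ξ s) - (z η t - z η s)) := by
          abel
        have h5 := norm_add_le (z ξ s - z η s) ((z ξ t - z ξ s) - (z η t - z η s))
        have h6 := norm_sub_le (z ξ t - z ξ s) (z η t - z η s)
        rw [← h4] at h5
        linarith
      linarith
    have hC0 : 0 ≤ C := (norm_nonneg _).trans
      (hC (0, 0) ⟨⟨le_rfl, two_pi_pos.le⟩, ⟨le_rfl, hT'.1.le⟩⟩)
    refine ⟨⟨2 * C, by linarith⟩, LipschitzOnWith.of_dist_le_mul ?_⟩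
    intro x hx y hy
    rw [Real.dist_eq, Real.dist_eq]
    have h1 := key x hx y hy
    have h2 := key y hy x hx
    rw [abs_sub_comm y x] at h1
    change |m x - m y| ≤ 2 * C * |x - y|
    rw [abs_le]
    constructor <;> linarith
  refine ⟨hlip, ?_⟩
  have hae : ∀ n : ℕ, ∀ᵐ t : ℝ, t ∈ Ioo 0 (T - T / ((n : ℝ) + 2)) → DifferentiableAt ℝ m t := by
    intro n
    have hn : (0 : ℝ) < (n : ℝ) + 2 := by positivity
    have h1 : T / ((n : ℝ) + 2) < T := by
      rw [div_lt_iff₀ hn]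
      have : (0 : ℝ) ≤ n := Nat.cast_nonneg n
      nlinarith
    have h2 : 0 < T / ((n : ℝ) + 2) := by positivity
    obtain ⟨K, hK⟩ := hlip (T - T / ((n : ℝ) + 2)) ⟨by linarith, by linarith⟩
    filter_upwards [hK.ae_differentiableWithinAt_of_mem] with t ht hmem
    exact (ht ⟨hmem.1.le, hmem.2.le⟩).differentiableAt (Icc_mem_nhds hmem.1 hmem.2)
  have hne : ∀ᵐ t : ℝ, t ≠ 0 := Measure.ae_ne volume 0
  filter_upwards [ae_all_iff.2 hae, hne] with t ht ht0 htm ξ η hd hmin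
  have htpos : 0 < t := lt_of_le_of_ne htm.1 (Ne.symm ht0)
  have hdiff : DifferentiableAt ℝ m t := by
    obtain ⟨n, hn⟩ := exists_nat_gt (T / (T - t))
    have hTt : 0 < T - t := sub_pos.2 htm.2
    refine ht n ⟨htpos, ?_⟩
    rw [div_lt_iff₀ hTt] at hn
    have hn2 : (0 : ℝ) < (n : ℝ) + 2 := by positivity
    have : T / ((n : ℝ) + 2) < T - t := by
      rw [div_lt_iff₀ hn2]
      nlinarith
    linarith
  have hnhds : Ico 0 T ∈ nhds t := Ico_mem_nhds htpos htm.2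
  have hg : HasDerivAt (fun s => z ξ s - z η s) (w ξ t - w η t) t :=
    ((hderiv ξ t htm).hasDerivAt hnhds).sub ((hderiv η t htm).hasDerivAt hnhds)
  have hmp := hmpos t htm
  have hsq := hg.norm_sq
  have hf : HasDerivAt (fun s => ‖z ξ s - z η s‖)
      ((m t)⁻¹ * dot (z ξ t - z η t) (w ξ t - w η t)) t := by
    have h := hsq.sqrt (by rw [hmin]; positivity)
    simp only [Real.sqrt_sq (norm_nonneg _)] at h
    convert h using 1
    rw [hmin]
    simp only [dot, PiLp.inner_apply, Fin.sum_univ_two, RCLike.inner_apply, conj_trivial]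
    field_simp
  have hmax : IsLocalMax (fun s => m s - ‖z ξ s - z η s‖) t := by
    refine Filter.Eventually.of_forall fun s => ?_
    have := hle s ξ η hd
    simp only [hmin, sub_self]
    linarith
  have h0 := hmax.hasDerivAt_eq_zero (hdiff.hasDerivAt.sub hf)
  rw [← sub_eq_zero.1 h0]
  exact hdiff.hasDerivAt

end
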